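/- arXiv:2405.02184 — 10 statements merged into one kernel-verified Lean document; each statement's English description precedes it below -/
import Mathlib

section
/- For every real τ_ε, if εₚ := r̄ − cosh(ω·τ_ε)·r̄ + sinh(ω·τ_ε)·(v̄/ω), then exp(ω·τ_ε) = η(εₚ); equivalently, τ_ε = (1/ω)·ln(η(εₚ)). -/
open Real

theorem stmt_4 (ω r v : ℝ) (hω : 0 < ω) (hr : 0 < r) (hv : v / ω - r > 0)
    (η : ℝ → ℝ)
    (hη : ∀ ε, η ε = (ε - r + Real.sqrt (ε ^ 2 - 2 * r * ε + (v / ω) ^ 2)) / (v / ω - r)) :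
    ∀ τε : ℝ, ∀ εp : ℝ,
      εp = r - Real.cosh (ω * τε) * r + Real.sinh (ω * τε) * (v / ω) →
      Real.exp (ω * τε) = η εp ∧ τε = (1 / ω) * Real.log (η εp) := by
  intro t ε hε
  have hcs := Real.cosh_sq (ω * t)
  have hlt : Real.sinh (ω * t) < Real.cosh (ω * t) := Real.sinh_lt_cosh _
  have hc : 0 < Real.cosh (ω * t) := Real.cosh_pos _
  have hexp : Real.cosh (ω * t) + Real.sinh (ω * t) = Real.exp (ω * t) :=
    Real.cosh_add_sinh _
  have key : Real.exp (ω * t) = η ε := by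
    rw [hη, eq_div_iff hv.ne', ← hexp]
    generalize v / ω = a at *
    generalize Real.cosh (ω * t) = c at *
    generalize Real.sinh (ω * t) = s at *
    have h1 : ε ^ 2 - 2 * r * ε + a ^ 2 = (c * a - s * r) ^ 2 := by
      subst hε
      linear_combination (r ^ 2 - a ^ 2) * hcs
    have h2 : 0 ≤ c * a - s * r := by
      nlinarith [mul_pos hc hv, mul_pos hr (sub_pos.2 hlt)]
    rw [h1, Real.sqrt_sq h2, hε]
    ring
  refine ⟨key, ?_⟩
  rw [← key, Real.log_exp]
  field_simp
end

section
/- The function η satisfies: η(0) = 1, η is strictly increasing on ℝ, η(ε) tends to +∞ as ε → +∞, and η(ε) tends to 0 as ε → −∞. Consequently the map ε ↦ (1/ω)·ln(η(ε)) is a continuous, strictly increasing function from ℝ onto ℝ that vanishes at 0 (an extended class 𝒦∞ function). -/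
open Real Filter

theorem stmt_5 (ω r v : ℝ) (hω : 0 < ω) (hr : 0 < r) (hv : v / ω - r > 0)
    (η : ℝ → ℝ)
    (hη : ∀ ε, η ε = (ε - r + Real.sqrt (ε ^ 2 - 2 * r * ε + (v / ω) ^ 2)) / (v / ω - r)) :
    η 0 = 1 ∧ StrictMono η ∧
    Tendsto η atTop atTop ∧ Tendsto η atBot (nhds 0) ∧
    (Continuous fun ε => (1 / ω) * Real.log (η ε)) ∧
    (StrictMono fun ε => (1 / ω) * Real.log (η ε)) ∧
    (Function.Surjective fun ε => (1 / ω) * Real.log (η ε)) ∧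
    (1 / ω) * Real.log (η 0) = 0 := by
  generalize v / ω = a at *
  have hc : 0 < a ^ 2 - r ^ 2 := by nlinarith
  have hnn : ∀ ε : ℝ, 0 ≤ ε ^ 2 - 2 * r * ε + a ^ 2 := fun ε => by
    nlinarith [sq_nonneg (ε - r)]
  have hsq : ∀ ε : ℝ, √(ε ^ 2 - 2 * r * ε + a ^ 2) ^ 2 = ε ^ 2 - 2 * r * ε + a ^ 2 :=
    fun ε => Real.sq_sqrt (hnn ε)
  have hs0 : ∀ ε : ℝ, 0 ≤ √(ε ^ 2 - 2 * r * ε + a ^ 2) := fun ε => Real.sqrt_nonneg _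
  have hnum : ∀ ε : ℝ, 0 < ε - r + √(ε ^ 2 - 2 * r * ε + a ^ 2) := fun ε => by
    by_contra h
    nlinarith [hsq ε, hs0 ε]
  have hpos : ∀ ε, 0 < η ε := fun ε => by
    rw [hη]; exact div_pos (hnum ε) hv
  have h0 : η 0 = 1 := by
    rw [hη]
    have : (0:ℝ) ^ 2 - 2 * r * 0 + a ^ 2 = a ^ 2 := by ring
    rw [this, Real.sqrt_sq (by linarith)]
    rw [div_eq_one_iff_eq hv.ne']; ring
  have hmono : StrictMono η := by
    intro x y hxy
    rw [hη, hη]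
    refine div_lt_div_of_pos_right ?_ hv
    have hx := hsq x
    have hy := hsq y
    have px := hnum x
    have py := hnum y
    generalize √(x ^ 2 - 2 * r * x + a ^ 2) = s at *
    generalize √(y ^ 2 - 2 * r * y + a ^ 2) = t at *
    by_contra h
    push Not at h
    have e1 : (x - r + s) * (s - (x - r)) = a ^ 2 - r ^ 2 := by linear_combination hx
    have e2 : (y - r + t) * (t - (y - r)) = a ^ 2 - r ^ 2 := by linear_combination hy
    have h1 : t - (y - r) < s - (x - r) := by linarith
    have h2 : 0 < s - (x - r) := by
      by_contra h'
      nlinarith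
    have h3 : (y - r + t) * (t - (y - r)) < (y - r + t) * (s - (x - r)) :=
      mul_lt_mul_of_pos_left h1 py
    have h4 := mul_le_mul_of_nonneg_right h h2.le
    linarith
  have hsurj : ∀ t : ℝ, 0 < t → ∃ ε, η ε = t := by
    intro t ht
    have hT : 0 < t * (a - r) := mul_pos ht hv
    refine ⟨r + (t * (a - r) - (a ^ 2 - r ^ 2) / (t * (a - r))) / 2, ?_⟩
    rw [hη, div_eq_iff hv.ne']
    generalize t * (a - r) = T at *
    have hq : 0 < (a ^ 2 - r ^ 2) / T := div_pos hc hT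
    have hqT : (a ^ 2 - r ^ 2) / T * T = a ^ 2 - r ^ 2 := div_mul_cancel₀ _ hT.ne'
    generalize (a ^ 2 - r ^ 2) / T = q at *
    have : (r + (T - q) / 2) ^ 2 - 2 * r * (r + (T - q) / 2) + a ^ 2 = ((T + q) / 2) ^ 2 := by
      linear_combination -hqT
    rw [this, Real.sqrt_sq (by linarith)]
    ring
  have hcont : Continuous η := by
    have : η = fun ε => (ε - r + √(ε ^ 2 - 2 * r * ε + a ^ 2)) / (a - r) := funext hη
    rw [this]
    fun_prop
  refine ⟨h0, hmono, ?_, ?_, ?_, ?_, ?_, ?_⟩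
  · refine hmono.monotone.tendsto_atTop_atTop fun b => ?_
    obtain ⟨e, he⟩ := hsurj (max b 1) (by positivity)
    exact ⟨e, he ▸ le_max_left _ _⟩
  · refine tendsto_order.2 ⟨fun b hb => .of_forall fun x => hb.trans (hpos x), fun b hb => ?_⟩
    obtain ⟨e, he⟩ := hsurj b hb
    filter_upwards [eventually_lt_atBot e] with x hx
    exact he ▸ hmono hx
  · exact continuous_const.mul (hcont.log fun x => (hpos x).ne')
  · intro x y hxy
    exact mul_lt_mul_of_pos_left (Real.log_lt_log (hpos x) (hmono hxy)) (by positivity)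
  · intro y
    obtain ⟨e, he⟩ := hsurj (Real.exp (ω * y)) (Real.exp_pos _)
    refine ⟨e, ?_⟩
    simp only [he, Real.log_exp]
    field_simp
  · rw [h0]; simp
end

section
/- The functions δ₁ and δ₂ are differentiable on ℝ and their derivatives satisfy, for every real ε: −2·r̄/(v̄/ω + r̄) ≤ δ₁′(ε) ≤ 2·r̄/(v̄/ω − r̄) = 2·ξ/ω, and −2·r̄·ω/(v̄/ω − r̄) = −2·ξ ≤ δ₂′(ε) ≤ −2·r̄·ω/(v̄/ω + r̄). -/
open Real

theorem stmt_10 (ω r v : ℝ) (hω : 0 < ω) (hr : 0 < r) (hv : v / ω - r > 0)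
    (η : ℝ → ℝ)
    (hη : ∀ ε, η ε = (ε - r + Real.sqrt (ε ^ 2 - 2 * r * ε + (v / ω) ^ 2)) / (v / ω - r))
    (ξ : ℝ) (hξ : ξ = r * ω / (v / ω - r))
    (δ₁ δ₂ : ℝ → ℝ)
    (hδ₁ : ∀ ε, δ₁ ε = r * (η ε + 1 / η ε - 2))
    (hδ₂ : ∀ ε, δ₂ ε = r * ω * (1 / η ε - η ε)) :
    Differentiable ℝ δ₁ ∧ Differentiable ℝ δ₂ ∧
    (∀ ε : ℝ,
      (-(2 * r) / (v / ω + r) ≤ deriv δ₁ ε ∧ deriv δ₁ ε ≤ 2 * r / (v / ω - r)) ∧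
      (-(2 * r * ω) / (v / ω - r) ≤ deriv δ₂ ε ∧ deriv δ₂ ε ≤ -(2 * r * ω) / (v / ω + r))) ∧
    2 * r / (v / ω - r) = 2 * ξ / ω ∧
    -(2 * r * ω) / (v / ω - r) = -(2 * ξ) := by
  generalize v / ω = a at *
  have hp : 0 < a + r := by linarith
  have hm : 0 < a - r := hv
  have hQ : ∀ ε : ℝ, 0 < ε ^ 2 - 2 * r * ε + a ^ 2 := fun ε => by
    nlinarith [sq_nonneg (ε - r), mul_pos hp hm]
  have hS : ∀ ε : ℝ, 0 < Real.sqrt (ε ^ 2 - 2 * r * ε + a ^ 2) := fun ε => Real.sqrt_pos.2 (hQ ε)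
  have hS2 : ∀ ε : ℝ, Real.sqrt (ε ^ 2 - 2 * r * ε + a ^ 2) ^ 2 = ε ^ 2 - 2 * r * ε + a ^ 2 :=
    fun ε => Real.sq_sqrt (hQ ε).le
  have hinv : ∀ ε, 1 / η ε = (Real.sqrt (ε ^ 2 - 2 * r * ε + a ^ 2) - (ε - r)) / (a + r) := by
    intro ε
    have hprod : (ε - r + Real.sqrt (ε ^ 2 - 2 * r * ε + a ^ 2)) *
        (Real.sqrt (ε ^ 2 - 2 * r * ε + a ^ 2) - (ε - r)) = (a - r) * (a + r) := by
      linear_combination hS2 ε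
    have hne : ε - r + Real.sqrt (ε ^ 2 - 2 * r * ε + a ^ 2) ≠ 0 := by
      intro h
      rw [h, zero_mul] at hprod
      exact (mul_pos hm hp).ne hprod
    rw [hη, one_div_div, div_eq_div_iff hne hp.ne']
    linear_combination -hprod
  have hd : ∀ ε : ℝ, HasDerivAt (fun ε : ℝ => Real.sqrt (ε ^ 2 - 2 * r * ε + a ^ 2))
      ((ε - r) / Real.sqrt (ε ^ 2 - 2 * r * ε + a ^ 2)) ε := by
    intro ε
    have h1 : HasDerivAt (fun ε : ℝ => ε ^ 2 - 2 * r * ε + a ^ 2) (2 * ε - 2 * r) ε := by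
      have h := ((hasDerivAt_pow 2 ε).sub ((hasDerivAt_id' ε).const_mul (2 * r))).add_const (a ^ 2)
      have e : ((2 : ℕ) : ℝ) * ε ^ (2 - 1) - 2 * r * 1 = 2 * ε - 2 * r := by norm_num
      rw [e] at h
      exact h
    convert h1.sqrt (hQ ε).ne' using 1
    have := (hS ε).ne'
    field_simp
  have hx : ∀ ε : ℝ, HasDerivAt (fun ε : ℝ => ε - r) 1 ε := fun ε => (hasDerivAt_id ε).sub_const r
  have e1 : δ₁ = fun ε => r * ((ε - r + Real.sqrt (ε ^ 2 - 2 * r * ε + a ^ 2)) / (a - r) +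
      (Real.sqrt (ε ^ 2 - 2 * r * ε + a ^ 2) - (ε - r)) / (a + r) - 2) := by
    funext ε
    rw [hδ₁, hinv, hη]
  have e2 : δ₂ = fun ε => r * ω * ((Real.sqrt (ε ^ 2 - 2 * r * ε + a ^ 2) - (ε - r)) / (a + r) -
      (ε - r + Real.sqrt (ε ^ 2 - 2 * r * ε + a ^ 2)) / (a - r)) := by
    funext ε
    rw [hδ₂, hinv, hη]
  have d1 : ∀ ε, HasDerivAt δ₁ (r * ((1 + (ε - r) / Real.sqrt (ε ^ 2 - 2 * r * ε + a ^ 2)) / (a - r) +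
      ((ε - r) / Real.sqrt (ε ^ 2 - 2 * r * ε + a ^ 2) - 1) / (a + r))) ε := by
    intro ε
    rw [e1]
    exact (((((hx ε).add (hd ε)).div_const (a - r)).add
      (((hd ε).sub (hx ε)).div_const (a + r))).sub_const 2).const_mul r
  have d2 : ∀ ε, HasDerivAt δ₂ (r * ω * (((ε - r) / Real.sqrt (ε ^ 2 - 2 * r * ε + a ^ 2) - 1) / (a + r) -
      (1 + (ε - r) / Real.sqrt (ε ^ 2 - 2 * r * ε + a ^ 2)) / (a - r))) ε := by
    intro ε
    rw [e2]
    exact ((((hd ε).sub (hx ε)).div_const (a + r)).sub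
      (((hx ε).add (hd ε)).div_const (a - r))).const_mul (r * ω)
  refine ⟨fun ε => (d1 ε).differentiableAt, fun ε => (d2 ε).differentiableAt, ?_, ?_, ?_⟩
  · intro ε
    rw [(d1 ε).deriv, (d2 ε).deriv]
    have habs : |ε - r| ≤ Real.sqrt (ε ^ 2 - 2 * r * ε + a ^ 2) := by
      apply Real.abs_le_sqrt
      nlinarith [mul_pos hp hm]
    have ht1 : (ε - r) / Real.sqrt (ε ^ 2 - 2 * r * ε + a ^ 2) ≤ 1 := by
      rw [div_le_one (hS ε)]
      exact (abs_le.1 habs).2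
    have ht2 : -1 ≤ (ε - r) / Real.sqrt (ε ^ 2 - 2 * r * ε + a ^ 2) := by
      rw [le_div_iff₀ (hS ε)]
      linarith [(abs_le.1 habs).1]
    generalize (ε - r) / Real.sqrt (ε ^ 2 - 2 * r * ε + a ^ 2) = t at ht1 ht2
    have hP : 0 < (a + r)⁻¹ := inv_pos.2 hp
    have hM : 0 < (a - r)⁻¹ := inv_pos.2 hm
    have hle : (a + r)⁻¹ ≤ (a - r)⁻¹ := inv_anti₀ hm (by linarith)
    simp only [div_eq_mul_inv]
    generalize (a + r)⁻¹ = P at *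
    generalize (a - r)⁻¹ = M at *
    have hrω := mul_pos hr hω
    have u1 : 0 ≤ 1 - t := by linarith
    have u2 : 0 ≤ 1 + t := by linarith
    have hd0 : 0 ≤ M - P := by linarith
    refine ⟨⟨?_, ?_⟩, ?_, ?_⟩
    · linarith [mul_nonneg hr.le (mul_nonneg u2 (add_pos hM hP).le)]
    · linarith [mul_nonneg hr.le (mul_nonneg u1 (add_pos hM hP).le)]
    · linarith [mul_nonneg hrω.le (mul_nonneg u1 hd0)]
    · linarith [mul_nonneg hrω.le (mul_nonneg u2 hd0)]
  · rw [hξ]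
    field_simp
  · rw [hξ]
    ring
end

section
/- For every real ε, the jump increments satisfy the linear bounds |δ₁(ε)| ≤ (2·ξ/ω)·|ε| and |δ₂(ε)| ≤ 2·ξ·|ε|. -/
open Real

theorem stmt_11 (ω r v : ℝ) (hω : 0 < ω) (hr : 0 < r) (hv : v / ω - r > 0)
    (η : ℝ → ℝ)
    (hη : ∀ ε, η ε = (ε - r + Real.sqrt (ε ^ 2 - 2 * r * ε + (v / ω) ^ 2)) / (v / ω - r))
    (ξ : ℝ) (hξ : ξ = r * ω / (v / ω - r))
    (δ₁ δ₂ : ℝ → ℝ)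
    (hδ₁ : ∀ ε, δ₁ ε = r * (η ε + 1 / η ε - 2))
    (hδ₂ : ∀ ε, δ₂ ε = r * ω * (1 / η ε - η ε)) :
    ∀ ε : ℝ, |δ₁ ε| ≤ (2 * ξ / ω) * |ε| ∧ |δ₂ ε| ≤ 2 * ξ * |ε| := by
  intro ε
  rw [hδ₁, hδ₂, hη, hξ]
  generalize v / ω = a at *
  set s := Real.sqrt (ε ^ 2 - 2 * r * ε + a ^ 2) with hs
  have hpos : 0 < a ^ 2 - r ^ 2 := by nlinarith
  have hnn : 0 ≤ ε ^ 2 - 2 * r * ε + a ^ 2 := by nlinarith [sq_nonneg (ε - r)]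
  have hsq : s ^ 2 = ε ^ 2 - 2 * r * ε + a ^ 2 := Real.sq_sqrt hnn
  have hs0 : 0 ≤ s := Real.sqrt_nonneg _
  have hE : ε ^ 2 = |ε| ^ 2 := (sq_abs ε).symm
  have he0 := abs_nonneg ε
  have hre : |r * ε| ≤ a * |ε| := by
    rw [abs_mul, abs_of_pos hr]
    exact mul_le_mul_of_nonneg_right (by linarith) he0
  obtain ⟨hre1, hre2⟩ := abs_le.mp hre
  have hup : s ≤ a + |ε| := by
    exact Real.sqrt_le_iff.mpr ⟨by linarith, by nlinarith⟩
  have hlo : a - |ε| ≤ s := Real.le_sqrt_of_sq_le (by nlinarith)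
  have hL : |s - a| ≤ |ε| := abs_le.mpr ⟨by linarith, by linarith⟩
  have hp : 0 < ε - r + s := by
    by_contra h
    nlinarith
  have ha : a - r ≠ 0 := by linarith
  have har : 0 < a + r := by linarith
  have hinv : 1 / ((ε - r + s) / (a - r)) = (s - ε + r) / (a + r) := by
    rw [one_div_div, div_eq_div_iff hp.ne' har.ne']
    nlinarith
  rw [hinv]
  have key : ∀ x y : ℝ, 0 < x → 0 < y → |x * (s - a) + y * ε| ≤ (x + y) * |ε| := by
    intro x y hx hy
    calc _ ≤ |x * (s - a)| + |y * ε| := abs_add_le _ _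
      _ = x * |s - a| + y * |ε| := by rw [abs_mul, abs_mul, abs_of_pos hx, abs_of_pos hy]
      _ ≤ _ := by nlinarith
  have e1 : r * ((ε - r + s) / (a - r) + (s - ε + r) / (a + r) - 2)
      = (2 * r / ((a - r) * (a + r))) * (a * (s - a) + r * ε) := by
    field_simp
    ring
  have e2 : r * ω * ((s - ε + r) / (a + r) - (ε - r + s) / (a - r))
      = -((2 * r * ω / ((a - r) * (a + r))) * (r * (s - a) + a * ε)) := by
    field_simp
    ring
  have ha0 : 0 < a := by linarith
  have hv' : 0 < a - r := hv
  have c1 : 0 < 2 * r / ((a - r) * (a + r)) := by positivity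
  have c2 : 0 < 2 * r * ω / ((a - r) * (a + r)) := by positivity
  constructor
  · rw [e1, abs_mul, abs_of_pos c1]
    refine (mul_le_mul_of_nonneg_left (key a r ha0 hr) c1.le).trans (le_of_eq ?_)
    field_simp
  · rw [e2, abs_neg, abs_mul, abs_of_pos c2]
    refine (mul_le_mul_of_nonneg_left (key r a hr ha0) c2.le).trans (le_of_eq ?_)
    field_simp
    ring
end

section
/- For every α > ω, the function δ_α is differentiable on ℝ and its derivative satisfies, for every real ε: exp(−(ω + 2·α)·T) − 1 ≤ δ_α′(ε) ≤ exp((ω − 2·α)·T) − 1 < 0; in particular δ_α is strictly decreasing. -/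
open Real

theorem stmt_12 (ω r v : ℝ) (hω : 0 < ω) (hr : 0 < r) (hv : v / ω - r > 0)
    (η : ℝ → ℝ)
    (hη : ∀ ε, η ε = (ε - r + Real.sqrt (ε ^ 2 - 2 * r * ε + (v / ω) ^ 2)) / (v / ω - r))
    (T : ℝ) (hT : T = (1 / ω) * Real.log ((v / ω + r) / (v / ω - r)))
    (δ₁ : ℝ → ℝ) (hδ₁ : ∀ ε, δ₁ ε = r * (η ε + 1 / η ε - 2)) :
    ∀ α : ℝ, α > ω →
      ∀ δα : ℝ → ℝ, (∀ ε, δα ε = Real.exp (-(2 * α * T)) * (ε + δ₁ ε) - ε) →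
        Differentiable ℝ δα ∧
        (∀ ε : ℝ,
          Real.exp (-((ω + 2 * α) * T)) - 1 ≤ deriv δα ε ∧
          deriv δα ε ≤ Real.exp ((ω - 2 * α) * T) - 1) ∧
        Real.exp ((ω - 2 * α) * T) - 1 < 0 ∧
        StrictAnti δα := by
  intro α hα δα hδα
  generalize v / ω = c at *
  have hcr : 0 < c - r := hv
  have hcr' : 0 < c + r := by linarith
  have hq : ∀ ε : ℝ, 0 < ε ^ 2 - 2 * r * ε + c ^ 2 := by
    intro ε
    nlinarith [sq_nonneg (ε - r), mul_pos hcr hcr']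
  have hlog : 0 < Real.log ((c + r) / (c - r)) := by
    apply Real.log_pos
    rw [lt_div_iff₀ hcr]; linarith
  have hT0 : 0 < T := by rw [hT]; positivity
  have hωT : Real.exp (ω * T) = (c + r) / (c - r) := by
    rw [hT, ← mul_assoc, mul_one_div_cancel hω.ne', one_mul, Real.exp_log (by positivity)]
  have hωT' : Real.exp (-(ω * T)) = (c - r) / (c + r) := by
    rw [Real.exp_neg, hωT, inv_div]
  have hneg : Real.exp ((ω - 2 * α) * T) - 1 < 0 := by
    have : Real.exp ((ω - 2 * α) * T) < 1 := by
      rw [Real.exp_lt_one_iff]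
      exact mul_neg_of_neg_of_pos (by linarith) hT0
    linarith
  have hsq : ∀ ε, Real.sqrt (ε ^ 2 - 2 * r * ε + c ^ 2) ^ 2 = ε ^ 2 - 2 * r * ε + c ^ 2 :=
    fun ε => Real.sq_sqrt (hq ε).le
  have hS : ∀ ε, 0 < Real.sqrt (ε ^ 2 - 2 * r * ε + c ^ 2) := fun ε => Real.sqrt_pos.2 (hq ε)
  have habs : ∀ ε, |ε - r| < Real.sqrt (ε ^ 2 - 2 * r * ε + c ^ 2) := by
    intro ε
    apply abs_lt_of_sq_lt_sq _ (hS ε).le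
    rw [hsq]
    nlinarith [mul_pos hcr hcr']
  have hform : δα = fun ε => Real.exp (-(2 * α * T)) * (ε + r * ((ε - r +
      Real.sqrt (ε ^ 2 - 2 * r * ε + c ^ 2)) / (c - r) +
      (Real.sqrt (ε ^ 2 - 2 * r * ε + c ^ 2) - (ε - r)) / (c + r) - 2)) - ε := by
    funext ε
    rw [hδα, hδ₁, hη]
    have h1 := (abs_lt.1 (habs ε)).1
    have h2 := hsq ε
    have h3 : 1 / ((ε - r + Real.sqrt (ε ^ 2 - 2 * r * ε + c ^ 2)) / (c - r)) =
        (Real.sqrt (ε ^ 2 - 2 * r * ε + c ^ 2) - (ε - r)) / (c + r) := by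
      rw [one_div_div, div_eq_div_iff (by linarith) hcr'.ne']
      linear_combination -h2
    rw [h3]
  have hder : ∀ ε, HasDerivAt δα (Real.exp (-(2 * α * T)) * (1 + r * (
      (1 + (ε - r) / Real.sqrt (ε ^ 2 - 2 * r * ε + c ^ 2)) / (c - r) +
      ((ε - r) / Real.sqrt (ε ^ 2 - 2 * r * ε + c ^ 2) - 1) / (c + r))) - 1) ε := by
    intro ε
    have hp : HasDerivAt (fun ε : ℝ => ε ^ 2 - 2 * r * ε + c ^ 2) (2 * ε - 2 * r) ε := by
      have := (((hasDerivAt_id ε).pow 2).sub ((hasDerivAt_id ε).const_mul (2 * r))).add_const (c ^ 2)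
      refine HasDerivAt.congr_deriv this ?_
      simp
    have hs : HasDerivAt (fun ε : ℝ => Real.sqrt (ε ^ 2 - 2 * r * ε + c ^ 2))
        ((ε - r) / Real.sqrt (ε ^ 2 - 2 * r * ε + c ^ 2)) ε := by
      convert hp.sqrt (hq ε).ne' using 1
      have := (hS ε).ne'
      field_simp
    have hi : HasDerivAt (fun ε : ℝ => ε - r) 1 ε := (hasDerivAt_id ε).sub_const r
    rw [hform]
    exact (((hasDerivAt_id ε).add (((((hi.add hs).div_const (c - r)).add
      ((hs.sub hi).div_const (c + r))).sub_const 2).const_mul r)).const_mul _).sub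
      (hasDerivAt_id ε)
  have hbd : ∀ ε : ℝ, Real.exp (-((ω + 2 * α) * T)) - 1 ≤ deriv δα ε ∧
      deriv δα ε ≤ Real.exp ((ω - 2 * α) * T) - 1 := by
    intro ε
    rw [(hder ε).deriv]
    have e1 : Real.exp (-((ω + 2 * α) * T)) =
        Real.exp (-(2 * α * T)) * ((c - r) / (c + r)) := by
      rw [← hωT', ← Real.exp_add]; congr 1; ring
    have e2 : Real.exp ((ω - 2 * α) * T) =
        Real.exp (-(2 * α * T)) * ((c + r) / (c - r)) := by
      rw [← hωT, ← Real.exp_add]; congr 1; ring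
    rw [e1, e2]
    have hE := (Real.exp_pos (-(2 * α * T))).le
    obtain ⟨ha, hb⟩ := abs_lt.1 (habs ε)
    have hp1 : -1 ≤ (ε - r) / Real.sqrt (ε ^ 2 - 2 * r * ε + c ^ 2) := by
      rw [le_div_iff₀ (hS ε)]; linarith
    have hp2 : (ε - r) / Real.sqrt (ε ^ 2 - 2 * r * ε + c ^ 2) ≤ 1 := by
      rw [div_le_iff₀ (hS ε)]; linarith
    generalize (ε - r) / Real.sqrt (ε ^ 2 - 2 * r * ε + c ^ 2) = p at hp1 hp2
    have k1 : 1 + r * ((1 + p) / (c - r) + (p - 1) / (c + r)) - (c - r) / (c + r) =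
        (1 + p) * (2 * r * c / ((c - r) * (c + r))) := by
      field_simp; ring
    have k2 : (c + r) / (c - r) - (1 + r * ((1 + p) / (c - r) + (p - 1) / (c + r))) =
        (1 - p) * (2 * r * c / ((c - r) * (c + r))) := by
      field_simp; ring
    have hc : 0 < c := by linarith
    have hk : 0 ≤ 2 * r * c / ((c - r) * (c + r)) := by positivity
    have l1 := mul_nonneg (by linarith : 0 ≤ 1 + p) hk
    have l2 := mul_nonneg (by linarith : 0 ≤ 1 - p) hk
    constructor
    · exact sub_le_sub_right (mul_le_mul_of_nonneg_left (by linarith) hE) 1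
    · exact sub_le_sub_right (mul_le_mul_of_nonneg_left (by linarith) hE) 1
  exact ⟨fun ε => (hder ε).differentiableAt, hbd, hneg,
    strictAnti_of_deriv_neg fun ε => (hbd ε).2.trans_lt hneg⟩
end

section
/- For every α > ω and every real ε, the rescaled jump increment satisfies |δ_α(ε)| = |exp(−2·α·T)·(ε + δ₁(ε)) − ε| ≤ (1 − exp(−(ω + 2·α)·T))·|ε|. -/
open Real

set_option maxHeartbeats 1000000 in
theorem stmt_13 (ω r v : ℝ) (hω : 0 < ω) (hr : 0 < r) (hv : v / ω - r > 0)
    (η : ℝ → ℝ)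
    (hη : ∀ ε, η ε = (ε - r + Real.sqrt (ε ^ 2 - 2 * r * ε + (v / ω) ^ 2)) / (v / ω - r))
    (T : ℝ) (hT : T = (1 / ω) * Real.log ((v / ω + r) / (v / ω - r)))
    (δ₁ : ℝ → ℝ) (hδ₁ : ∀ ε, δ₁ ε = r * (η ε + 1 / η ε - 2)) :
    ∀ α : ℝ, α > ω → ∀ ε : ℝ,
      |Real.exp (-(2 * α * T)) * (ε + δ₁ ε) - ε| ≤
        (1 - Real.exp (-((ω + 2 * α) * T))) * |ε| := by
  intro α hα ε
  set c := v / ω with hc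
  have hcr : 0 < c - r := hv
  have hcp : 0 < c + r := by linarith
  have hcpos : 0 < c := by linarith
  have hQ : 0 < ε ^ 2 - 2 * r * ε + c ^ 2 := by nlinarith [sq_nonneg (ε - r)]
  obtain ⟨S, hS⟩ : ∃ S, S = Real.sqrt (ε ^ 2 - 2 * r * ε + c ^ 2) := ⟨_, rfl⟩
  have hS0 : 0 < S := hS ▸ Real.sqrt_pos.mpr hQ
  have hS2 : S ^ 2 = ε ^ 2 - 2 * r * ε + c ^ 2 := by rw [hS, Real.sq_sqrt hQ.le]
  have hprod : (ε - r + S) * (S - (ε - r)) = (c - r) * (c + r) := by linear_combination hS2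
  have hne : ε - r + S ≠ 0 := by
    intro h
    rw [h, zero_mul] at hprod
    have := mul_pos hcr hcp
    linarith
  have hinv : 1 / η ε = (S - (ε - r)) / (c + r) := by
    rw [hη, ← hS, one_div_div, div_eq_div_iff hne hcp.ne']
    linarith
  have hD : (ε + δ₁ ε) * ((c - r) * (c + r))
      = ε * ((c - r) * (c + r)) + 2 * r * (c * S + r * ε - c ^ 2) := by
    rw [hδ₁, hinv, hη, ← hS]
    field_simp
    ring
  set D := ε + δ₁ ε with hDdef
  have hkpos : 0 < (c + r) / (c - r) := div_pos hcp hcr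
  have hωT : Real.exp (ω * T) = (c + r) / (c - r) := by
    have : ω * T = Real.log ((c + r) / (c - r)) := by
      rw [hT]; field_simp
    rw [this, Real.exp_log hkpos]
  set k := (c + r) / (c - r) with hk
  have hkm : k * (c - r) = c + r := by rw [hk]; field_simp
  have hk1 : 1 < k := by rw [hk, lt_div_iff₀ hcr]; linarith
  have hTpos : 0 < T := by
    have h1 : 0 < ω * T := by
      rw [← Real.one_lt_exp_iff, hωT]; exact hk1
    exact pos_of_mul_pos_right h1 hω.le
  set E := Real.exp (-(2 * α * T)) with hE
  have hEpos : 0 < E := Real.exp_pos _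
  have hEk : E * k ≤ 1 := by
    rw [← hωT, hE, ← Real.exp_add, Real.exp_le_one_iff]
    nlinarith [mul_pos (sub_pos.mpr hα) hTpos, mul_pos hω hTpos]
  have hR : Real.exp (-((ω + 2 * α) * T)) = E * ((c - r) / (c + r)) := by
    have : (c - r) / (c + r) = Real.exp (-(ω * T)) := by
      rw [Real.exp_neg, hωT, hk, inv_div]
    rw [this, hE, ← Real.exp_add]
    congr 1; ring
  rw [hR]
  set m := (c - r) / (c + r) with hm
  have hmm : m * (c + r) = c - r := by rw [hm]; field_simp
  have hP : 0 < (c - r) * (c + r) := mul_pos hcr hcp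
  have hrc : 0 < 2 * r * c := by positivity
  have e1 : (D - m * ε) * ((c - r) * (c + r)) = 2 * r * c * (S - (c - ε)) := by
    linear_combination hD - ε * (c - r) * hmm
  have e2 : (k * ε - D) * ((c - r) * (c + r)) = 2 * r * c * (c + ε - S) := by
    linear_combination -hD + ε * (c + r) * hkm
  have hm1 : m ≤ 1 := by rw [hm, div_le_one hcp]; linarith
  have hEm : E * m ≤ 1 :=
    (mul_le_mul_of_nonneg_left (hm1.trans hk1.le) hEpos.le).trans hEk
  rcases le_total 0 ε with h | h
  · have a1 : c - ε ≤ S := by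
      apply le_of_not_gt; intro hh
      nlinarith [mul_nonneg hcr.le h]
    have a2 : S ≤ c + ε := by
      apply le_of_not_gt; intro hh
      nlinarith [mul_nonneg hcp.le h]
    have b1 : 0 ≤ D - m * ε := by
      refine nonneg_of_mul_nonneg_left ?_ hP
      rw [e1]; exact mul_nonneg hrc.le (by linarith)
    have b2 : 0 ≤ k * ε - D := by
      refine nonneg_of_mul_nonneg_left ?_ hP
      rw [e2]; exact mul_nonneg hrc.le (by linarith)
    rw [abs_of_nonneg h, abs_le]
    have p1 := mul_nonneg hEpos.le b1
    have p2 := mul_nonneg hEpos.le b2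
    have p3 := mul_nonneg (sub_nonneg.mpr hEk) h
    have p4 : 0 ≤ (1 - E * m) * ε := by
      apply mul_nonneg _ h
      linarith [hEm]
    constructor <;> linarith
  · have a1 : S ≤ c - ε := by
      apply le_of_not_gt; intro hh
      nlinarith [mul_nonneg hcr.le (neg_nonneg.mpr h)]
    have a2 : c + ε ≤ S := by
      apply le_of_not_gt; intro hh
      nlinarith [mul_nonneg hcp.le (neg_nonneg.mpr h)]
    have b1 : 0 ≤ -(D - m * ε) := by
      refine nonneg_of_mul_nonneg_left ?_ hP
      rw [neg_mul, e1, ← mul_neg]; exact mul_nonneg hrc.le (by linarith)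
    have b2 : 0 ≤ -(k * ε - D) := by
      refine nonneg_of_mul_nonneg_left ?_ hP
      rw [neg_mul, e2, ← mul_neg]; exact mul_nonneg hrc.le (by linarith)
    rw [abs_of_nonpos h, abs_le]
    have p1 := mul_nonneg hEpos.le b1
    have p2 := mul_nonneg hEpos.le b2
    have p3 := mul_nonneg (sub_nonneg.mpr hEk) (neg_nonneg.mpr h)
    have p4 : 0 ≤ (1 - E * m) * (-ε) := by
      apply mul_nonneg _ (neg_nonneg.mpr h)
      linarith [hEm]
    constructor <;> linarith
end

section
/- For every real ε, the post-jump position error satisfies |ε + δ₁(ε)| ≤ (1 + 2·r̄/(v̄/ω − r̄))·|ε| = ((v̄/ω + r̄)/(v̄/ω − r̄))·|ε| = exp(ω·T)·|ε|. -/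
open Real

theorem stmt_14 (ω r v : ℝ) (hω : 0 < ω) (hr : 0 < r) (hv : v / ω - r > 0)
    (η : ℝ → ℝ)
    (hη : ∀ ε, η ε = (ε - r + Real.sqrt (ε ^ 2 - 2 * r * ε + (v / ω) ^ 2)) / (v / ω - r))
    (T : ℝ) (hT : T = (1 / ω) * Real.log ((v / ω + r) / (v / ω - r)))
    (δ₁ : ℝ → ℝ) (hδ₁ : ∀ ε, δ₁ ε = r * (η ε + 1 / η ε - 2)) :
    ∀ ε : ℝ,
      |ε + δ₁ ε| ≤ (1 + 2 * r / (v / ω - r)) * |ε| ∧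
      (1 + 2 * r / (v / ω - r)) * |ε| = ((v / ω + r) / (v / ω - r)) * |ε| ∧
      ((v / ω + r) / (v / ω - r)) * |ε| = Real.exp (ω * T) * |ε| := by
  intro ε
  have hη' := hη ε
  have hδ' := hδ₁ ε
  have hωT : ω * T = Real.log ((v / ω + r) / (v / ω - r)) := by
    rw [hT]; field_simp
  rw [hωT]
  clear hωT hT hη hδ₁
  generalize v / ω = a at *
  generalize η ε = h at *
  generalize δ₁ ε = d at *
  have hd : 0 < a - r := hv
  have hs : 0 < a + r := by linarith
  have heq : 1 + 2 * r / (a - r) = (a + r) / (a - r) := by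
    field_simp; ring
  refine ⟨?_, by rw [heq], by rw [Real.exp_log (div_pos hs hd)]⟩
  rw [heq]
  have hrad : ε ^ 2 - 2 * r * ε + a ^ 2 = (ε - r) ^ 2 + (a - r) * (a + r) := by ring
  have hprod : 0 < (a - r) * (a + r) := mul_pos hd hs
  rw [hrad] at hη'
  have hSq := Real.sq_sqrt (show 0 ≤ (ε - r) ^ 2 + (a - r) * (a + r) by positivity)
  have hS0 := Real.sqrt_nonneg ((ε - r) ^ 2 + (a - r) * (a + r))
  generalize Real.sqrt ((ε - r) ^ 2 + (a - r) * (a + r)) = S at *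
  have hpos : 0 < ε - r + S := by
    have : |ε - r| < S := abs_lt_of_sq_lt_sq (by linarith) hS0
    linarith [(abs_lt.mp this).1]
  have hh : 0 < h := by rw [hη']; exact div_pos hpos hd
  have h1 : h * (a - r) = ε - r + S := by rw [hη']; field_simp
  have hS : S = h * (a - r) - (ε - r) := by linarith
  have key : 2 * h * ε = (h - 1) * ((a - r) * h + (a + r)) := by
    apply mul_left_cancel₀ hd.ne'
    rw [hS] at hSq
    linear_combination -hSq
  have hdh : h * d = r * (h - 1) ^ 2 := by
    rw [hδ']; field_simp; ring
  have key2 : 2 * h * (ε + d) = (h - 1) * ((a + r) * h + (a - r)) := by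
    linear_combination key + 2 * hdh
  have e1 : 2 * h * |ε| = |h - 1| * ((a - r) * h + (a + r)) := by
    have := congrArg abs key
    rwa [abs_mul (2 * h), abs_mul (h - 1), abs_of_pos (show 0 < 2 * h by positivity),
      abs_of_pos (show 0 < (a - r) * h + (a + r) by positivity)] at this
  have e2 : 2 * h * |ε + d| = |h - 1| * ((a + r) * h + (a - r)) := by
    have := congrArg abs key2
    rwa [abs_mul (2 * h), abs_mul (h - 1), abs_of_pos (show 0 < 2 * h by positivity),
      abs_of_pos (show 0 < (a + r) * h + (a - r) by positivity)] at this
  rw [div_mul_eq_mul_div, le_div_iff₀ hd]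
  have h2 : 0 < 2 * h := by positivity
  refine le_of_mul_le_mul_left ?_ h2
  have hab : 0 ≤ |h - 1| * (4 * a * r) :=
    mul_nonneg (abs_nonneg _) (by nlinarith)
  calc 2 * h * (|ε + d| * (a - r)) = |h - 1| * ((a + r) * h + (a - r)) * (a - r) := by
        rw [← e2]; ring
    _ ≤ |h - 1| * ((a - r) * h + (a + r)) * (a + r) := by linarith
    _ = 2 * h * ((a + r) * |ε|) := by rw [← e1]; ring
end

section
/- For every α > 0, the following linear matrix inequality system is feasible if and only if α > ω: there exist a symmetric 2×2 real matrix Q with entries q₁₁, q₁₂, q₂₂, a real U, row vectors W, Y ∈ ℝ^{1×2} and a real X such that (i) Q is positive definite, (ii) U > 0, (iii) Δ(Q) is negative definite, (iv) the symmetrization M + Mᵀ of the 3×3 block matrix M = [[α·Q + A·Q + B·W, B·(X − U)], [W + Y, X − U]] is negative definite, and (v) the 3×3 block matrix [[ū², Y], [Yᵀ, Q]] is positive semidefinite. -/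
open Real Matrix

lemma aux_two (a b c : ℝ) (ha : 0 < a) (h : b ^ 2 < a * c) :
    (!![a, b; b, c] : Matrix (Fin 2) (Fin 2) ℝ).PosDef := by
  refine Matrix.PosDef.of_dotProduct_mulVec_pos ?_ ?_
  · ext i j
    fin_cases i <;> fin_cases j <;> simp
  · intro x hx
    simp [Matrix.mulVec, dotProduct, Fin.sum_univ_two]
    have key : a * (x 0 * (a * x 0 + b * x 1) + x 1 * (b * x 0 + c * x 1))
        = (a * x 0 + b * x 1) ^ 2 + (a * c - b ^ 2) * x 1 ^ 2 := by ring
    have h2 : 0 < a * c - b ^ 2 := by linarith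
    refine pos_of_mul_pos_right (a := a) ?_ ha.le
    rw [key]
    by_cases h1 : x 1 = 0
    · have h0 : x 0 ≠ 0 := by
        intro h0
        apply hx
        ext i
        fin_cases i <;> simp [h0, h1]
      rw [h1]
      have : 0 < (a * x 0) ^ 2 := by positivity
      simpa using this
    · have : 0 < (a * c - b ^ 2) * x 1 ^ 2 := by positivity
      positivity

lemma aux_lt (ω : ℝ) (A : Matrix (Fin 2) (Fin 2) ℝ) (hA : A = !![0, 1; ω ^ 2, 0])
    (B : Matrix (Fin 2) (Fin 1) ℝ) (hB : B = !![0; -ω ^ 2]) (ε α p q y1 y2 : ℝ) (hε : 0 < ε)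
    (hp : p = α + 1)
    (h1 : ω ^ 2 * y1 = 2 * α * p - q - ω ^ 2) (h2 : ω ^ 2 * y2 = -1 - α * q + ω ^ 2 * p)
    (Q : Matrix (Fin 2) (Fin 2) ℝ) (hQ : Q = !![ε, -(ε * p); -(ε * p), ε * q])
    (W Y : Matrix (Fin 1) (Fin 2) ℝ) (hY : Y = !![ε * y1, ε * y2])
    (hW : W = !![-(ε * y1), -(ε * y2) + ω ^ 2]) :
    (-(Matrix.fromBlocks (α • Q + A * Q + B * W) (((0:ℝ) - 1) • B) (W + Y) !![(0:ℝ) - 1] +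
       (Matrix.fromBlocks (α • Q + A * Q + B * W) (((0:ℝ) - 1) • B) (W + Y)
          !![(0:ℝ) - 1])ᵀ)).PosDef := by
  refine Matrix.PosDef.of_dotProduct_mulVec_pos ?_ ?_
  · rw [Matrix.IsHermitian, Matrix.conjTranspose_eq_transpose_of_trivial]
    simp only [Matrix.transpose_neg, Matrix.transpose_add, Matrix.transpose_transpose]
    rw [add_comm]
  · intro x hx
    have key : star x ⬝ᵥ ((-(Matrix.fromBlocks (α • Q + A * Q + B * W) (((0:ℝ) - 1) • B) (W + Y)
        !![(0:ℝ) - 1] + (Matrix.fromBlocks (α • Q + A * Q + B * W) (((0:ℝ) - 1) • B) (W + Y)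
          !![(0:ℝ) - 1])ᵀ)) *ᵥ x) =
        2 * (ε * x (Sum.inl 0) ^ 2 + ε * x (Sum.inl 1) ^ 2 +
          (x (Sum.inr 0) - ω ^ 2 * x (Sum.inl 1)) ^ 2) := by
      subst hA hB hQ hY hW hp
      simp [Matrix.mulVec, dotProduct, Fin.sum_univ_two, Fintype.sum_sum_type]
      generalize x (Sum.inl 0) = a
      generalize x (Sum.inl 1) = b
      generalize x (Sum.inr 0) = c
      linear_combination (-2 * ε * a * b) * h1 + (-2 * ε * b ^ 2) * h2
    rw [key]
    by_contra hn
    have e0 : 0 ≤ ε * x (Sum.inl 0) ^ 2 := by positivity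
    have e1 : 0 ≤ ε * x (Sum.inl 1) ^ 2 := by positivity
    have e2 := sq_nonneg (x (Sum.inr 0) - ω ^ 2 * x (Sum.inl 1))
    have z0 : ε * x (Sum.inl 0) ^ 2 = 0 := by linarith
    have z1 : ε * x (Sum.inl 1) ^ 2 = 0 := by linarith
    have z2 : (x (Sum.inr 0) - ω ^ 2 * x (Sum.inl 1)) ^ 2 = 0 := by linarith
    have w0 : x (Sum.inl 0) = 0 := by simpa [hε.ne'] using z0
    have w1 : x (Sum.inl 1) = 0 := by simpa [hε.ne'] using z1
    have w2 : x (Sum.inr 0) = 0 := by simpa [w1] using z2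
    apply hx
    ext i
    rcases i with i | i <;> fin_cases i <;> simp [w0, w1, w2]

lemma aux_psd (u ε p q y1 y2 : ℝ) (hε : 0 < ε) (hq : p ^ 2 + 1 ≤ q)
    (hK : ε * (y1 ^ 2 + (y2 + p * y1) ^ 2) ≤ u ^ 2)
    (Q : Matrix (Fin 2) (Fin 2) ℝ) (hQ : Q = !![ε, -(ε * p); -(ε * p), ε * q])
    (Y : Matrix (Fin 1) (Fin 2) ℝ) (hY : Y = !![ε * y1, ε * y2]) :
    (Matrix.fromBlocks !![u ^ 2] Y Yᵀ Q).PosSemidef := by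
  refine Matrix.PosSemidef.of_dotProduct_mulVec_nonneg ?_ ?_
  · subst hQ hY
    ext i j
    rcases i with i | i <;> rcases j with j | j <;> fin_cases i <;> fin_cases j <;> simp
  · intro x
    have key : star x ⬝ᵥ ((Matrix.fromBlocks !![u ^ 2] Y Yᵀ Q) *ᵥ x) =
        ε * (x (Sum.inr 0) - p * x (Sum.inr 1) + x (Sum.inl 0) * y1) ^ 2 +
        ε * (x (Sum.inr 1) + x (Sum.inl 0) * (y2 + p * y1)) ^ 2 +
        ε * ((q - p ^ 2 - 1) * x (Sum.inr 1) ^ 2) +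
        (u ^ 2 - ε * (y1 ^ 2 + (y2 + p * y1) ^ 2)) * x (Sum.inl 0) ^ 2 := by
      subst hQ hY
      simp [Matrix.mulVec, dotProduct, Fin.sum_univ_two, Fintype.sum_sum_type]
      ring
    rw [key]
    have a1 : 0 ≤ q - p ^ 2 - 1 := by linarith
    have a2 : 0 ≤ u ^ 2 - ε * (y1 ^ 2 + (y2 + p * y1) ^ 2) := by linarith
    positivity

theorem stmt_15 (ω r v : ℝ) (hω : 0 < ω) (hr : 0 < r) (hv : v / ω - r > 0)
    (T : ℝ) (hT : T = (1 / ω) * Real.log ((v / ω + r) / (v / ω - r)))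
    (ξ : ℝ) (hξ : ξ = r * ω / (v / ω - r))
    (A : Matrix (Fin 2) (Fin 2) ℝ) (hA : A = !![0, 1; ω ^ 2, 0])
    (B : Matrix (Fin 2) (Fin 1) ℝ) (hB : B = !![0; -ω ^ 2])
    (u : ℝ) (hu : 0 < u) :
    ∀ α : ℝ, 0 < α →
      ((∃ q₁₁ q₁₂ q₂₂ : ℝ, ∃ U : ℝ, ∃ W Y : Matrix (Fin 1) (Fin 2) ℝ, ∃ X : ℝ,
          (!![q₁₁, q₁₂; q₁₂, q₂₂] : Matrix (Fin 2) (Fin 2) ℝ).PosDef ∧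
          0 < U ∧
          (-(!![(Real.exp (2 * (ω - α) * T) - 1) * q₂₂ +
                  4 * Real.exp (-(2 * α * T)) * ξ * (ξ * q₁₁ - Real.exp (ω * T) * q₁₂),
                2 * Real.exp (-(2 * α * T)) * ξ * q₁₁ +
                  (Real.exp (-((ω + 2 * α) * T)) - 1) * q₁₂;
                2 * Real.exp (-(2 * α * T)) * ξ * q₁₁ +
                  (Real.exp (-((ω + 2 * α) * T)) - 1) * q₁₂,
                (Real.exp (-(2 * α * T)) - 1) * q₁₁] : Matrix (Fin 2) (Fin 2) ℝ)).PosDef ∧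
          (-(Matrix.fromBlocks
                (α • !![q₁₁, q₁₂; q₁₂, q₂₂] + A * !![q₁₁, q₁₂; q₁₂, q₂₂] + B * W)
                ((X - U) • B) (W + Y) !![X - U] +
              (Matrix.fromBlocks
                (α • !![q₁₁, q₁₂; q₁₂, q₂₂] + A * !![q₁₁, q₁₂; q₁₂, q₂₂] + B * W)
                ((X - U) • B) (W + Y) !![X - U])ᵀ)).PosDef ∧
          (Matrix.fromBlocks !![u ^ 2] Y Yᵀ !![q₁₁, q₁₂; q₁₂, q₂₂]).PosSemidef) ↔
        α > ω) := by
  intro α hα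
  have hE1 : 1 < (v / ω + r) / (v / ω - r) := by
    rw [lt_div_iff₀ hv]; linarith
  have hTpos : 0 < T := by
    rw [hT]; exact mul_pos (by positivity) (Real.log_pos hE1)
  have hξpos : 0 < ξ := by
    rw [hξ]; exact div_pos (by positivity) hv
  constructor
  · rintro ⟨q₁₁, q₁₂, q₂₂, U, W, Y, X, hQ, hU, hD, hM, -⟩
    by_contra hle
    have hle : α ≤ ω := not_lt.mp hle
    have h11 : 0 < q₁₁ := by simpa using hQ.diag_pos (i := 0)
    have h22 : 0 < q₂₂ := by simpa using hQ.diag_pos (i := 1)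
    have d := hD.diag_pos (i := 0)
    have m := hM.diag_pos (i := Sum.inl 0)
    subst hA hB
    simp [Matrix.vecHead, Matrix.vecMul, dotProduct] at m
    simp at d
    have h12 : q₁₂ < 0 := by nlinarith [mul_pos hα h11]
    have e1 : 1 ≤ Real.exp (2 * (ω - α) * T) := by
      apply Real.one_le_exp
      have : 0 ≤ ω - α := by linarith
      positivity
    have e2 := Real.exp_pos (-(2 * α * T))
    have e3 := Real.exp_pos (ω * T)
    have t1 : 0 ≤ (Real.exp (2 * (ω - α) * T) - 1) * q₂₂ :=
      mul_nonneg (by linarith) h22.le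
    have t2 : 0 < ξ * q₁₁ - Real.exp (ω * T) * q₁₂ := by
      nlinarith [mul_pos hξpos h11, mul_pos e3 (neg_pos.mpr h12)]
    have t3 : 0 < 4 * Real.exp (-(2 * α * T)) * ξ * (ξ * q₁₁ - Real.exp (ω * T) * q₁₂) := by
      positivity
    linarith
  · intro hαω
    have e1 : Real.exp (2 * (ω - α) * T) < 1 := by
      rw [Real.exp_lt_one_iff]
      nlinarith
    have e2 : Real.exp (-(2 * α * T)) < 1 := by
      rw [Real.exp_lt_one_iff]
      nlinarith [mul_pos hα hTpos]
    generalize Real.exp (2 * (ω - α) * T) = c at *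
    have e2' := Real.exp_pos (-(2 * α * T))
    generalize Real.exp (-(2 * α * T)) = e at *
    have e3 := Real.exp_pos (ω * T)
    generalize Real.exp (ω * T) = E at *
    generalize Real.exp (-((ω + 2 * α) * T)) = d at *
    obtain ⟨p, hp⟩ : ∃ p, p = α + 1 := ⟨_, rfl⟩
    have hp0 : 0 < p := by linarith
    obtain ⟨b, hb⟩ : ∃ b, b = 2 * e * ξ - (d - 1) * p := ⟨_, rfl⟩
    have hc : 0 < 1 - c := by linarith
    have he : 0 < 1 - e := by linarith
    obtain ⟨R, hR⟩ : ∃ R, R = 4 * e * ξ * (ξ + E * p) := ⟨_, rfl⟩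
    have hR0 : 0 < R := by rw [hR]; positivity
    obtain ⟨q, hq⟩ : ∃ q, q = p ^ 2 + 1 + (R + 1 + b ^ 2 / (1 - e)) / (1 - c) := ⟨_, rfl⟩
    have hq1 : p ^ 2 + 1 ≤ q := by
      rw [hq]
      have : 0 ≤ (R + 1 + b ^ 2 / (1 - e)) / (1 - c) := by positivity
      linarith
    have hP : 1 + b ^ 2 / (1 - e) ≤ (1 - c) * q - R := by
      have : (1 - c) * q = (1 - c) * (p ^ 2 + 1) + (R + 1 + b ^ 2 / (1 - e)) := by
        rw [hq]; field_simp
      rw [this]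
      have : 0 ≤ (1 - c) * (p ^ 2 + 1) := by positivity
      linarith
    have hP0 : 0 < (1 - c) * q - R := by
      have : 0 ≤ b ^ 2 / (1 - e) := by positivity
      linarith
    have hPd : b ^ 2 < ((1 - c) * q - R) * (1 - e) := by
      have h := mul_le_mul_of_nonneg_right hP he.le
      have h' : (1 + b ^ 2 / (1 - e)) * (1 - e) = (1 - e) + b ^ 2 := by field_simp
      linarith
    obtain ⟨y1, hy1⟩ : ∃ y, y = (2 * α * p - q - ω ^ 2) / ω ^ 2 := ⟨_, rfl⟩
    obtain ⟨y2, hy2⟩ : ∃ y, y = (-1 - α * q + ω ^ 2 * p) / ω ^ 2 := ⟨_, rfl⟩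
    have h1 : ω ^ 2 * y1 = 2 * α * p - q - ω ^ 2 := by rw [hy1]; field_simp
    have h2 : ω ^ 2 * y2 = -1 - α * q + ω ^ 2 * p := by rw [hy2]; field_simp
    obtain ⟨K, hK⟩ : ∃ K, K = y1 ^ 2 + (y2 + p * y1) ^ 2 := ⟨_, rfl⟩
    have hK0 : 0 ≤ K := by rw [hK]; positivity
    obtain ⟨ε, hε⟩ : ∃ ε, ε = u ^ 2 / (K + 1) := ⟨_, rfl⟩
    have hε0 : 0 < ε := by rw [hε]; positivity
    have hεK : ε * K ≤ u ^ 2 := by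
      have : ε * (K + 1) = u ^ 2 := by rw [hε]; field_simp
      linarith
    refine ⟨ε, -(ε * p), ε * q, 1, !![-(ε * y1), -(ε * y2) + ω ^ 2], !![ε * y1, ε * y2], 0,
      ?_, one_pos, ?_, ?_, ?_⟩
    · apply aux_two _ _ _ hε0
      have : 0 < ε * ε * (q - p ^ 2) := mul_pos (by positivity) (by linarith)
      linarith
    · have := aux_two (ε * ((1 - c) * q - R)) (-(ε * b)) (ε * (1 - e)) (by positivity) (by
        have : 0 < ε * ε * (((1 - c) * q - R) * (1 - e) - b ^ 2) :=
          mul_pos (by positivity) (by linarith)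
        linarith)
      convert this using 1
      subst hb hR
      ext i j
      fin_cases i <;> fin_cases j <;> simp <;> ring
    · exact aux_lt ω A hA B hB ε α p q y1 y2 hε0 hp h1 h2 _ rfl _ _ rfl rfl
    · exact aux_psd u ε p q y1 y2 hε0 hq1 (by rw [← hK]; exact hεK) _ rfl _ rfl
end

section
/- Let α > 0 and let q₁₁ > 0 and q₂₂ > 4·α²·q₁₁ be reals, set q₁₂ = −2·α·q₁₁, and let Q be the symmetric 2×2 matrix with these entries. Define k̄₁ = q₂₂/q₁₁ + 4·α²·q₂₂/(q₂₂ − 4·α²·q₁₁), k̄₂ = 2·α + 2·α·q₂₂/(q₂₂ − 4·α²·q₁₁), and the row vector K = [(k̄₁ + ω²)/ω², k̄₂/ω²]. Then the symmetrization R = M + Mᵀ of M = (α·I + A + B·K)·Q equals the diagonal matrix diag(−2·α·q₁₁, −2·α·q₂₂), which is negative definite. -/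
open Real Matrix

theorem stmt_16 (ω : ℝ) (hω : 0 < ω)
    (A : Matrix (Fin 2) (Fin 2) ℝ) (hA : A = !![0, 1; ω ^ 2, 0])
    (B : Matrix (Fin 2) (Fin 1) ℝ) (hB : B = !![0; -ω ^ 2])
    (α q₁₁ q₂₂ : ℝ) (hα : 0 < α) (hq₁₁ : 0 < q₁₁) (hq₂₂ : 4 * α ^ 2 * q₁₁ < q₂₂)
    (q₁₂ : ℝ) (hq₁₂ : q₁₂ = -(2 * α * q₁₁))
    (Q : Matrix (Fin 2) (Fin 2) ℝ) (hQ : Q = !![q₁₁, q₁₂; q₁₂, q₂₂])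
    (k₁ k₂ : ℝ)
    (hk₁ : k₁ = q₂₂ / q₁₁ + 4 * α ^ 2 * q₂₂ / (q₂₂ - 4 * α ^ 2 * q₁₁))
    (hk₂ : k₂ = 2 * α + 2 * α * q₂₂ / (q₂₂ - 4 * α ^ 2 * q₁₁))
    (K : Matrix (Fin 1) (Fin 2) ℝ) (hK : K = !![(k₁ + ω ^ 2) / ω ^ 2, k₂ / ω ^ 2])
    (M : Matrix (Fin 2) (Fin 2) ℝ) (hM : M = (α • (1 : Matrix (Fin 2) (Fin 2) ℝ) + A + B * K) * Q) :
    M + Mᵀ = !![-(2 * α * q₁₁), 0; 0, -(2 * α * q₂₂)] ∧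
    (-(M + Mᵀ)).PosDef := by
  have hD : q₂₂ - 4 * α ^ 2 * q₁₁ ≠ 0 := by linarith
  have hq : q₁₁ ≠ 0 := hq₁₁.ne'
  have hw : ω ≠ 0 := hω.ne'
  have hq2 : 0 < q₂₂ := lt_trans (by positivity) hq₂₂
  have e1 : ω ^ 2 * ((k₁ + ω ^ 2) / ω ^ 2) = k₁ + ω ^ 2 := by field_simp
  have e2 : ω ^ 2 * (k₂ / ω ^ 2) = k₂ := by field_simp
  have hC : α • (1 : Matrix (Fin 2) (Fin 2) ℝ) + A + B * K = !![α, 1; -k₁, α - k₂] := by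
    subst hA hB hK
    ext i j
    fin_cases i <;> fin_cases j <;> simp [Matrix.mul_apply] <;> linarith
  have h12 : 2 * α * q₁₂ + q₂₂ - k₁ * q₁₁ - k₂ * q₁₂ = 0 := by
    rw [hk₁, hk₂, hq₁₂]; field_simp; ring
  have h22 : -k₁ * q₁₂ + (α - k₂) * q₂₂ = -(α * q₂₂) := by
    rw [hk₁, hk₂, hq₁₂]
    obtain ⟨D, hDd⟩ : ∃ D, D = q₂₂ - 4 * α ^ 2 * q₁₁ := ⟨_, rfl⟩
    rw [← hDd] at hD ⊢
    field_simp
    rw [hDd]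
    ring
  have hR : M + Mᵀ = !![-(2 * α * q₁₁), 0; 0, -(2 * α * q₂₂)] := by
    rw [hM, hC, hQ]
    ext i j
    fin_cases i <;> fin_cases j <;> simp [Matrix.mul_apply, Fin.sum_univ_two] <;> linarith
  refine ⟨hR, ?_⟩
  have hd : -(M + Mᵀ) = Matrix.diagonal ![2 * α * q₁₁, 2 * α * q₂₂] := by
    rw [hR]
    ext i j
    fin_cases i <;> fin_cases j <;> simp
  rw [hd]
  refine Matrix.PosDef.diagonal ?_
  intro i
  fin_cases i <;> simp <;> positivity
end

section
/- Assume α > ω, q₁₁ > 0, q₂₂ > 0 and q₁₂ < 0. For all real εₚ, ε_v, setting εₚ⁺ = εₚ + δ₁(εₚ) and ε_v⁺ = ε_v + δ₂(εₚ), the jump variation satisfies q₂₂·(exp(−2·α·T)·(εₚ⁺)² − εₚ²) − 2·q₁₂·(exp(−2·α·T)·εₚ⁺·ε_v⁺ − εₚ·ε_v) + q₁₁·(exp(−2·α·T)·(ε_v⁺)² − ε_v²) ≤ (|εₚ|, |ε_v|)·Δ(Q)·(|εₚ|, |ε_v|)ᵀ; moreover, if additionally Δ(Q) is negative definite and (εₚ,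 ε_v) ≠ (0, 0), then this quantity is strictly negative. -/
open Real Matrix

lemma aux_eta (V r ε : ℝ) (hr : 0 < r) (hV : V - r > 0) (h : ℝ)
    (hh : h = (ε - r + Real.sqrt (ε ^ 2 - 2 * r * ε + V ^ 2)) / (V - r)) :
    0 < h ∧ 2 * h * ε = (h - 1) * ((V - r) * h + (V + r)) := by
  have hpos : 0 < ε ^ 2 - 2 * r * ε + V ^ 2 := by nlinarith [sq_nonneg (ε - r)]
  set s := Real.sqrt (ε ^ 2 - 2 * r * ε + V ^ 2) with hs
  have hs2 : s ^ 2 = ε ^ 2 - 2 * r * ε + V ^ 2 := Real.sq_sqrt hpos.le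
  have hs0 : 0 ≤ s := Real.sqrt_nonneg _
  have h1 : 0 < ε - r + s := by
    have : |ε - r| < s := by
      apply abs_lt_of_sq_lt_sq _ hs0
      nlinarith
    linarith [(abs_lt.mp this).1]
  have h2 : h * (V - r) = ε - r + s := by rw [hh]; field_simp
  have hp : 0 < h := by rw [hh]; positivity
  refine ⟨hp, ?_⟩
  have h3 : s = h * (V - r) - ε + r := by linarith
  rw [h3] at hs2
  have : (V - r) * (2 * h * ε - (h - 1) * ((V - r) * h + (V + r))) = 0 := by
    linear_combination -hs2
  rcases mul_eq_zero.mp this with h4 | h4 <;> linarith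

lemma aux_cross (c E ρ x y : ℝ) (hc : 0 < c) (hE : 1 < E) (hcE : c * E < 1)
    (h1 : 1 / E ≤ ρ) (h2 : ρ ≤ E) :
    (c * ρ - 1) * (x * y) ≤ (1 - c / E) * (|x| * |y|) := by
  have h3 : c / E ≤ c * ρ := by
    have := mul_le_mul_of_nonneg_left h1 hc.le
    rwa [mul_one_div] at this
  have h4 : c * ρ ≤ 1 := (mul_le_mul_of_nonneg_left h2 hc.le).trans hcE.le
  rw [← abs_mul]
  have h5 : -(x * y) ≤ |x * y| := neg_le_abs _
  have h6 := abs_nonneg (x * y)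
  nlinarith [mul_le_mul_of_nonneg_left h5 (sub_nonneg.mpr h4)]

lemma aux_main (c E ξ ρ κ q₁₁ q₁₂ q₂₂ x y : ℝ) (hc : 0 < c) (hE : 1 < E) (hcE : c * E < 1)
    (h1 : 1 / E ≤ ρ) (h2 : ρ ≤ E) (hκ : 0 ≤ κ) (hκ2 : κ ≤ 2 * ξ)
    (h₁₁ : 0 < q₁₁) (h₂₂ : 0 < q₂₂) (h₁₂ : q₁₂ < 0) :
    q₂₂ * (c * (ρ * x) ^ 2 - x ^ 2) - 2 * q₁₂ * (c * (ρ * x) * (y - κ * x) - x * y)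
      + q₁₁ * (c * (y - κ * x) ^ 2 - y ^ 2) ≤
    ((c * E ^ 2 - 1) * q₂₂ + 4 * c * ξ * (ξ * q₁₁ - E * q₁₂)) * |x| ^ 2
      + 2 * (2 * c * ξ * q₁₁ + (c / E - 1) * q₁₂) * (|x| * |y|) + (c - 1) * q₁₁ * |y| ^ 2 := by
  have hρ : 0 < ρ := lt_of_lt_of_le (by positivity) h1
  have hξ : 0 ≤ ξ := by linarith
  have a1 : q₂₂ * (c * (ρ * x) ^ 2 - x ^ 2) ≤ (c * E ^ 2 - 1) * q₂₂ * |x| ^ 2 := by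
    rw [sq_abs]
    have : ρ ^ 2 ≤ E ^ 2 := by gcongr
    have := mul_le_mul_of_nonneg_left this (by positivity : 0 ≤ q₂₂ * c * x ^ 2)
    linarith
  have a2 : -2 * q₁₂ * ((c * ρ - 1) * (x * y)) ≤ -2 * q₁₂ * ((1 - c / E) * (|x| * |y|)) :=
    mul_le_mul_of_nonneg_left (aux_cross c E ρ x y hc hE hcE h1 h2) (by linarith)
  have a3 : 0 ≤ -2 * q₁₂ * (c * ρ * κ * x ^ 2) :=
    mul_nonneg (by linarith) (by positivity)
  have a4 : 0 ≤ -q₁₂ * (4 * c * ξ * E * |x| ^ 2) :=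
    mul_nonneg (by linarith) (by positivity)
  have a5 : (y - κ * x) ^ 2 ≤ (|y| + 2 * ξ * |x|) ^ 2 := by
    apply sq_le_sq.mpr
    rw [abs_of_nonneg (by positivity : 0 ≤ |y| + 2 * ξ * |x|)]
    calc |y - κ * x| ≤ |y| + |κ * x| := abs_sub _ _
      _ = |y| + κ * |x| := by rw [abs_mul, abs_of_nonneg hκ]
      _ ≤ _ := by gcongr
  have a6 := mul_le_mul_of_nonneg_left a5 (by positivity : 0 ≤ q₁₁ * c)
  have a7 := sq_abs y
  nlinarith

theorem stmt_18 (ω r v : ℝ) (hω : 0 < ω) (hr : 0 < r) (hv : v / ω - r > 0)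
    (η : ℝ → ℝ)
    (hη : ∀ ε, η ε = (ε - r + Real.sqrt (ε ^ 2 - 2 * r * ε + (v / ω) ^ 2)) / (v / ω - r))
    (T : ℝ) (hT : T = (1 / ω) * Real.log ((v / ω + r) / (v / ω - r)))
    (ξ : ℝ) (hξ : ξ = r * ω / (v / ω - r))
    (δ₁ δ₂ : ℝ → ℝ)
    (hδ₁ : ∀ ε, δ₁ ε = r * (η ε + 1 / η ε - 2))
    (hδ₂ : ∀ ε, δ₂ ε = r * ω * (1 / η ε - η ε))
    (α q₁₁ q₁₂ q₂₂ : ℝ) (hα : α > ω)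
    (h₁₁ : 0 < q₁₁) (h₂₂ : 0 < q₂₂) (h₁₂ : q₁₂ < 0)
    (Δ : Matrix (Fin 2) (Fin 2) ℝ)
    (hΔ : Δ = !![(Real.exp (2 * (ω - α) * T) - 1) * q₂₂ +
            4 * Real.exp (-(2 * α * T)) * ξ * (ξ * q₁₁ - Real.exp (ω * T) * q₁₂),
          2 * Real.exp (-(2 * α * T)) * ξ * q₁₁ +
            (Real.exp (-((ω + 2 * α) * T)) - 1) * q₁₂;
          2 * Real.exp (-(2 * α * T)) * ξ * q₁₁ +
            (Real.exp (-((ω + 2 * α) * T)) - 1) * q₁₂,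
          (Real.exp (-(2 * α * T)) - 1) * q₁₁]) :
    ∀ εp εv : ℝ, ∀ εp' εv' : ℝ,
      εp' = εp + δ₁ εp → εv' = εv + δ₂ εp →
      (q₂₂ * (Real.exp (-(2 * α * T)) * εp' ^ 2 - εp ^ 2) -
          2 * q₁₂ * (Real.exp (-(2 * α * T)) * εp' * εv' - εp * εv) +
          q₁₁ * (Real.exp (-(2 * α * T)) * εv' ^ 2 - εv ^ 2) ≤
        ![|εp|, |εv|] ⬝ᵥ Δ.mulVec ![|εp|, |εv|]) ∧
      ((-Δ).PosDef → (εp, εv) ≠ (0, 0) →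
        q₂₂ * (Real.exp (-(2 * α * T)) * εp' ^ 2 - εp ^ 2) -
            2 * q₁₂ * (Real.exp (-(2 * α * T)) * εp' * εv' - εp * εv) +
            q₁₁ * (Real.exp (-(2 * α * T)) * εv' ^ 2 - εv ^ 2) < 0) := by
  intro εp εv εp' εv' hp' hv'
  set V := v / ω with hV
  obtain ⟨hpos, heq⟩ := aux_eta V r εp hr hv (η εp) (hη εp)
  have hD1 := hδ₁ εp
  have hD2 := hδ₂ εp
  set h := η εp with hh
  have hVr : 0 < V + r := by linarith
  have hE1 : Real.exp (ω * T) = (V + r) / (V - r) := by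
    have : ω * T = Real.log ((V + r) / (V - r)) := by rw [hT]; field_simp
    rw [this, Real.exp_log (by positivity)]
  have hE : 1 < Real.exp (ω * T) := by
    rw [hE1, lt_div_iff₀ hv]; linarith
  have hωT : 0 < ω * T := Real.one_lt_exp_iff.mp hE
  have hTpos : 0 < T := (mul_pos_iff_of_pos_left hω).mp hωT
  have hc : 0 < Real.exp (-(2 * α * T)) := Real.exp_pos _
  have hcE : Real.exp (-(2 * α * T)) * Real.exp (ω * T) < 1 := by
    rw [← Real.exp_add, Real.exp_lt_one_iff]; nlinarith
  have hcE2 : Real.exp (2 * (ω - α) * T) = Real.exp (-(2 * α * T)) * Real.exp (ω * T) ^ 2 := by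
    rw [sq, ← Real.exp_add, ← Real.exp_add]; congr 1; ring
  have hcE3 : Real.exp (-((ω + 2 * α) * T)) = Real.exp (-(2 * α * T)) / Real.exp (ω * T) := by
    rw [← Real.exp_sub]; congr 1; ring
  rw [hcE2, hcE3] at hΔ
  have hden : 0 < (V - r) * h + (V + r) := by positivity
  have hε : εp = (h - 1) * ((V - r) * h + (V + r)) / (2 * h) := by
    field_simp; linarith
  have e1 : εp' = ((V + r) * h + (V - r)) / ((V - r) * h + (V + r)) * εp := by
    rw [hp', hD1, hε]; field_simp; ring
  have e2 : εv' = εv - 2 * r * ω * (1 + h) / ((V - r) * h + (V + r)) * εp := by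
    rw [hv', hD2, hε]; field_simp; ring
  have b1 : 1 / Real.exp (ω * T) ≤ ((V + r) * h + (V - r)) / ((V - r) * h + (V + r)) := by
    rw [hE1, one_div_div, div_le_div_iff₀ hVr hden]
    nlinarith [mul_pos (mul_pos hr hpos) (by linarith : 0 < V)]
  have b2 : ((V + r) * h + (V - r)) / ((V - r) * h + (V + r)) ≤ Real.exp (ω * T) := by
    rw [hE1, div_le_div_iff₀ hden hv]
    nlinarith [mul_pos hr (by linarith : 0 < V)]
  have b3 : 0 ≤ 2 * r * ω * (1 + h) / ((V - r) * h + (V + r)) := by positivity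
  have b4 : 2 * r * ω * (1 + h) / ((V - r) * h + (V + r)) ≤ 2 * ξ := by
    rw [hξ, ← mul_div_assoc, div_le_div_iff₀ hden hv]
    nlinarith [mul_pos (mul_pos hr hω) hr]
  have key := aux_main _ _ ξ _ _ q₁₁ q₁₂ q₂₂ εp εv hc hE hcE b1 b2 b3 b4 h₁₁ h₂₂ h₁₂
  rw [← e1, ← e2] at key
  have first : q₂₂ * (Real.exp (-(2 * α * T)) * εp' ^ 2 - εp ^ 2) -
          2 * q₁₂ * (Real.exp (-(2 * α * T)) * εp' * εv' - εp * εv) +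
          q₁₁ * (Real.exp (-(2 * α * T)) * εv' ^ 2 - εv ^ 2) ≤
        ![|εp|, |εv|] ⬝ᵥ Δ.mulVec ![|εp|, |εv|] := by
    refine key.trans (le_of_eq ?_)
    rw [hΔ]
    simp [Matrix.mulVec, dotProduct, Fin.sum_univ_two, -sq_abs]
    ring
  refine ⟨first, fun hPD hne => lt_of_le_of_lt first ?_⟩
  have hx : (![|εp|, |εv|] : Fin 2 → ℝ) ≠ 0 := by
    intro h0
    apply hne
    have h00 := congrFun h0 0
    have h01 := congrFun h0 1
    simp at h00 h01
    simp [h00, h01]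
  have := hPD.dotProduct_mulVec_pos hx
  rw [Matrix.neg_mulVec, dotProduct_neg] at this
  rw [star_trivial] at this
  linarith
end
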